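/- Consider the ring of k cliques, each of size s ≥ 2 (with k·s nodes, and consecutive cliques joined by one edge), with natural clustering T_{k,s} into the k cliques. As k → ∞ with s fixed: (a) the latitude of the clustering vector b(T_{k,s}) tends to 0, since m_{T} = k·C(s,2) while N = C(ks,2); (b) for any fixed γ > 0, the latitude of the ER-modularity vector q = v(A) − γ(m/N)·1, where m = k·C(s,2) + k is the number of edges, tends to π/2; consequently d_a(q, b(T_{k,s})) ≥ |ℓ(q) − ℓ(b(T_{k,s}))| → π/2. -/

import Mathlib

open Real BigOperators Filter

noncomputable section

/-- Index type for node pairs i < j of [n]. -/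
abbrev PairIdx (n : ℕ) := {p : Fin n × Fin n // p.1 < p.2}

/-- Inner product on ℝ^N indexed by node pairs. -/
def inn {n : ℕ} (x y : PairIdx n → ℝ) : ℝ := ∑ p : PairIdx n, x p * y p

/-- Euclidean norm. -/
def nrm {n : ℕ} (x : PairIdx n → ℝ) : ℝ := Real.sqrt (inn x x)

/-- Angular distance d_a(x,y) = arccos(⟨x,y⟩/(‖x‖‖y‖)). -/
def angDist {n : ℕ} (x y : PairIdx n → ℝ) : ℝ :=
  Real.arccos (inn x y / (nrm x * nrm y))

/-- The all-ones vector. -/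
def allOnes (n : ℕ) : PairIdx n → ℝ := fun _ => 1

/-- Latitude ℓ(x) = d_a(x, -1). -/
def lat {n : ℕ} (x : PairIdx n → ℝ) : ℝ := angDist x (fun _ => -1)

/-- Clustering vector of a clustering given by a label function. -/
def bvec {n : ℕ} {L : Type*} [DecidableEq L] (c : Fin n → L) : PairIdx n → ℝ :=
  fun p => if c p.1.1 = c p.1.2 then 1 else -1

/-- Intra-cluster pairs of a clustering. -/
def intraP {n : ℕ} {L : Type*} [DecidableEq L] (c : Fin n → L) : Finset (PairIdx n) :=
  Finset.univ.filter (fun p => c p.1.1 = c p.1.2)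

/-- Inter-cluster pairs of a clustering. -/
def interP {n : ℕ} {L : Type*} [DecidableEq L] (c : Fin n → L) : Finset (PairIdx n) :=
  Finset.univ.filter (fun p => c p.1.1 ≠ c p.1.2)

/-- Pearson correlation between two vectors. -/
def pearson {n : ℕ} (x y : PairIdx n → ℝ) : ℝ :=
  inn (fun p => x p - inn x (allOnes n) / (n.choose 2 : ℝ))
      (fun p => y p - inn y (allOnes n) / (n.choose 2 : ℝ)) /
  (nrm (fun p => x p - inn x (allOnes n) / (n.choose 2 : ℝ)) *
   nrm (fun p => y p - inn y (allOnes n) / (n.choose 2 : ℝ)))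

/-- Clique label of a node in the ring of k cliques of size s. -/
def cliqueOf (k s : ℕ) (i : Fin (k * s)) : ℕ := (i : ℕ) / s

/-- Adjacency of the ring of cliques: all within-clique edges, plus one edge joining
clique a (its node with position 0) to clique a+1 mod k (its node with position 1). -/
def ringAdj (k s : ℕ) (i j : Fin (k * s)) : Prop :=
  i ≠ j ∧ ((i : ℕ) / s = (j : ℕ) / s ∨
    ((j : ℕ) / s = ((i : ℕ) / s + 1) % k ∧ (i : ℕ) % s = 0 ∧ (j : ℕ) % s = 1) ∨
    ((i : ℕ) / s = ((j : ℕ) / s + 1) % k ∧ (j : ℕ) % s = 0 ∧ (i : ℕ) % s = 1))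

instance (k s : ℕ) (i j : Fin (k * s)) : Decidable (ringAdj k s i j) := by
  unfold ringAdj; infer_instance

/-- Adjacency vector of the ring of cliques. -/
def ringVec (k s : ℕ) : PairIdx (k * s) → ℝ :=
  fun p => if ringAdj k s p.1.1 p.1.2 then 1 else 0

/-- Number of edges of the ring of cliques: m = k·C(s,2) + k. -/
def ringEdges (k s : ℕ) : ℕ := k * s.choose 2 + k

/-- ER-modularity query vector of the ring of cliques. -/
def ringQ (k s : ℕ) (γ : ℝ) : PairIdx (k * s) → ℝ :=
  fun p => ringVec k s p - γ * ((ringEdges k s : ℝ) / ((k * s).choose 2 : ℝ))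

theorem angDist_eq_angle {n : ℕ} (x y : PairIdx n → ℝ) :
    angDist x y = InnerProductGeometry.angle (WithLp.toLp 2 x) (WithLp.toLp 2 y) := by
  simp [angDist, InnerProductGeometry.angle, nrm, inn, EuclideanSpace.norm_eq,
    PiLp.inner_apply, mul_comm, pow_two]

theorem abs_lat_sub_lat_le_angDist {n : ℕ} (x y : PairIdx n → ℝ) :
    |lat x - lat y| ≤ angDist x y := by
  simp only [lat, angDist_eq_angle]
  set u := WithLp.toLp 2 x
  set v := WithLp.toLp 2 y
  set w := WithLp.toLp 2 (fun _ : PairIdx n => (-1 : ℝ))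
  have huv := InnerProductGeometry.angle_le_angle_add_angle u v w
  have hvu := InnerProductGeometry.angle_le_angle_add_angle v u w
  rw [InnerProductGeometry.angle_comm v u] at hvu
  rw [abs_sub_le_iff]
  constructor <;> linarith

theorem card_pairIdx (n : ℕ) : Fintype.card (PairIdx n) = n.choose 2 := by
  rw [Fintype.card_subtype, Finset.card_filter, Fintype.sum_prod_type_right]
  simp only [← Finset.card_filter]
  have hlt (x : Fin n) : (Finset.univ.filter (· < x)).card = (x : ℕ) := by
    rw [Finset.filter_gt_eq_Iio, Fin.card_Iio]
  simp only [hlt]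
  rw [Fin.sum_univ_eq_sum_range (fun i => i), Finset.sum_range_id, Nat.choose_two_right]

theorem sq_le_choose_mul_two {k s : ℕ} (hs : 2 ≤ s) : k ^ 2 ≤ (k * s).choose 2 := by
  rcases Nat.eq_zero_or_pos k with rfl | hk
  · simp
  have hks : 2 * k ≤ k * s := by nlinarith
  refine le_trans ?_ (Nat.choose_le_choose 2 hks)
  rw [Nat.choose_two_right, Nat.le_div_iff_mul_le two_pos]
  obtain ⟨j, rfl⟩ : ∃ j, k = j + 1 := ⟨k - 1, by omega⟩
  rw [show 2 * (j + 1) - 1 = 2 * j + 1 by omega]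
  nlinarith

theorem nrm_neg_one (n : ℕ) : nrm (fun _ : PairIdx n => (-1 : ℝ)) = √(n.choose 2 : ℝ) := by
  simp [nrm, inn, card_pairIdx]

theorem lat_bvec {n : ℕ} {L : Type*} [DecidableEq L] (c : Fin n → L) :
    lat (bvec c) =
      arccos (((n.choose 2 : ℝ) - 2 * (intraP c).card) / (n.choose 2 : ℝ)) := by
  have hnrm : nrm (bvec c) = √(n.choose 2 : ℝ) := by
    have h (p : PairIdx n) : bvec c p * bvec c p = 1 := by
      unfold bvec; split_ifs <;> norm_num
    simp [nrm, inn, h, card_pairIdx]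
  have hinn : inn (bvec c) (fun _ => -1) = (n.choose 2 : ℝ) - 2 * (intraP c).card := by
    have h (p : PairIdx n) : bvec c p * -1 =
        1 - 2 * (if c p.1.1 = c p.1.2 then 1 else 0) := by
      unfold bvec; split_ifs <;> norm_num
    simp only [inn, h, Finset.sum_sub_distrib, ← Finset.mul_sum, Finset.sum_boole, intraP]
    simp [card_pairIdx]
  rw [lat, angDist, hnrm, nrm_neg_one, hinn, Real.mul_self_sqrt (Nat.cast_nonneg _)]

/-- The edges of the ring of cliques, as node pairs. -/
def ringEdgePairs (k s : ℕ) : Finset (PairIdx (k * s)) :=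
  Finset.univ.filter (fun p => ringAdj k s p.1.1 p.1.2)

theorem mem_ringEdgePairs {k s : ℕ} {p : PairIdx (k * s)} :
    p ∈ ringEdgePairs k s ↔ ringAdj k s p.1.1 p.1.2 := by
  simp [ringEdgePairs]

theorem mem_intraP_cliqueOf {k s : ℕ} {p : PairIdx (k * s)} :
    p ∈ intraP (cliqueOf k s) ↔ (p.1.1 : ℕ) / s = (p.1.2 : ℕ) / s := by
  rw [intraP, Finset.mem_filter_univ, cliqueOf, cliqueOf]

theorem card_intraP_cliqueOf_le (k : ℕ) {s : ℕ} (hs : 0 < s) :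
    (intraP (cliqueOf k s)).card ≤ k * s ^ 2 := by
  have h := Finset.card_le_card_of_injOn (s := intraP (cliqueOf k s))
    (t := Finset.range (k * s) ×ˢ Finset.range s)
    (fun p => ((p.1.1 : ℕ), (p.1.2 : ℕ) % s))
    (fun p _ => by simp [Nat.mod_lt _ hs])
    (by
      rintro ⟨⟨i, j⟩, hij⟩ hp ⟨⟨i', j'⟩, hij'⟩ hp' he
      rw [Finset.mem_coe, mem_intraP_cliqueOf] at hp hp'
      simp only [Prod.mk.injEq] at he
      obtain ⟨hi, hj⟩ := he
      have hji : (j : ℕ) = j' := by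
        rw [← Nat.div_add_mod (j : ℕ) s, ← Nat.div_add_mod (j' : ℕ) s, ← hp, ← hp', hi, hj]
      simp [Fin.ext_iff, hi, hji])
  simpa [mul_assoc, pow_two] using h

theorem card_ringEdgePairs_le (k : ℕ) {s : ℕ} (hs : 0 < s) :
    (ringEdgePairs k s).card ≤ k * (s ^ 2 + 2 * s) := by
  let up : Finset (PairIdx (k * s)) := Finset.univ.filter fun p =>
    (p.1.2 : ℕ) / s = ((p.1.1 : ℕ) / s + 1) % k ∧ (p.1.2 : ℕ) % s = 1
  let down : Finset (PairIdx (k * s)) := Finset.univ.filter fun p =>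
    (p.1.1 : ℕ) / s = ((p.1.2 : ℕ) / s + 1) % k ∧ (p.1.1 : ℕ) % s = 1
  have hup : up.card ≤ k * s := by
    refine (Finset.card_le_card_of_injOn (t := Finset.univ) (fun p => p.1.1) (by simp) ?_).trans
      (by simp)
    rintro ⟨⟨i, j⟩, hij⟩ hp ⟨⟨i', j'⟩, hij'⟩ hp' he
    simp only [up, Finset.coe_filter, Finset.mem_univ, true_and, Set.mem_ofPred_eq] at hp hp' he
    subst he
    have hjj : (j : ℕ) = j' := by
      rw [← Nat.div_add_mod (j : ℕ) s, ← Nat.div_add_mod (j' : ℕ) s, hp.1, hp'.1, hp.2, hp'.2]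
    simp [Fin.ext_iff, hjj]
  have hdown : down.card ≤ k * s := by
    refine (Finset.card_le_card_of_injOn (t := Finset.univ) (fun p => p.1.2) (by simp) ?_).trans
      (by simp)
    rintro ⟨⟨i, j⟩, hij⟩ hp ⟨⟨i', j'⟩, hij'⟩ hp' he
    simp only [down, Finset.coe_filter, Finset.mem_univ, true_and, Set.mem_ofPred_eq] at hp hp' he
    subst he
    have hii : (i : ℕ) = i' := by
      rw [← Nat.div_add_mod (i : ℕ) s, ← Nat.div_add_mod (i' : ℕ) s, hp.1, hp'.1, hp.2, hp'.2]
    simp [Fin.ext_iff, hii]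
  have hsub : ringEdgePairs k s ⊆ intraP (cliqueOf k s) ∪ (up ∪ down) := by
    intro p hp
    rw [mem_ringEdgePairs, ringAdj] at hp
    simp only [up, down, Finset.mem_union, mem_intraP_cliqueOf, Finset.mem_filter,
      Finset.mem_univ, true_and]
    tauto
  have := Finset.card_le_card hsub
  have := Finset.card_union_le (intraP (cliqueOf k s)) (up ∪ down)
  have := Finset.card_union_le up down
  have := card_intraP_cliqueOf_le k hs
  linarith

theorem le_card_ringEdgePairs (k : ℕ) {s : ℕ} (hs : 2 ≤ s) :
    k ≤ (ringEdgePairs k s).card := by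
  have hlt (a : Fin k) : (a : ℕ) * s + 1 < k * s := by
    have := Nat.mul_le_mul_right s (Nat.succ_le_of_lt a.2)
    rw [Nat.succ_mul] at this
    omega
  have h := Finset.card_le_card_of_injOn (s := (Finset.univ : Finset (Fin k)))
    (t := ringEdgePairs k s)
    (fun a => ⟨(⟨a * s, by have := hlt a; omega⟩, ⟨a * s + 1, hlt a⟩), by simp⟩)
    (fun a _ => by
      rw [Finset.mem_coe, mem_ringEdgePairs]
      refine ⟨by simp [Fin.ext_iff], Or.inl ?_⟩
      dsimp only
      rw [Nat.mul_div_cancel _ (by omega), mul_comm, Nat.mul_add_div (by omega),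
        Nat.div_eq_of_lt (by omega), add_zero])
    (fun a _ b _ he => by
      simp only [Subtype.mk.injEq, Prod.mk.injEq, Fin.mk.injEq] at he
      exact Fin.ext (Nat.eq_of_mul_eq_mul_right (by omega) he.1))
  simpa using h

theorem sum_ringVec (k s : ℕ) : ∑ p, ringVec k s p = (ringEdgePairs k s).card := by
  simp [ringVec, ringEdgePairs]

theorem tendsto_lat_bvec {s : ℕ} (hs : 2 ≤ s) :
    Tendsto (fun k => lat (bvec (cliqueOf k s))) atTop (nhds 0) := by
  simp only [lat_bvec]
  rw [← arccos_one]
  refine (continuous_arccos.tendsto 1).comp ?_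
  have hfrac : Tendsto (fun k : ℕ =>
      ((intraP (cliqueOf k s)).card : ℝ) / ((k * s).choose 2 : ℝ)) atTop (nhds 0) := by
    refine squeeze_zero' (.of_forall fun k => by positivity) ?_
      (tendsto_const_div_atTop_nhds_zero_nat ((s : ℝ) ^ 2))
    filter_upwards [eventually_gt_atTop 0] with k hk
    have hk' : (0 : ℝ) < k := by exact_mod_cast hk
    have hN : (k : ℝ) ^ 2 ≤ ((k * s).choose 2 : ℝ) := by exact_mod_cast sq_le_choose_mul_two hs
    have hm : ((intraP (cliqueOf k s)).card : ℝ) ≤ k * s ^ 2 := by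
      exact_mod_cast card_intraP_cliqueOf_le k (by omega)
    calc ((intraP (cliqueOf k s)).card : ℝ) / ((k * s).choose 2 : ℝ)
        ≤ (k * s ^ 2) / (k : ℝ) ^ 2 := by gcongr
      _ = s ^ 2 / k := by field_simp
  have h1 := (hfrac.const_mul 2).const_sub 1
  rw [mul_zero, sub_zero] at h1
  refine h1.congr' ?_
  filter_upwards [eventually_gt_atTop 0] with k hk
  have hN : ((k * s).choose 2 : ℝ) ≠ 0 := by
    have := sq_le_choose_mul_two (k := k) hs
    have : 0 < k ^ 2 := by positivity
    exact_mod_cast (by omega : (k * s).choose 2 ≠ 0)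
  field_simp

theorem inn_ringQ_neg_one {k s : ℕ} (γ : ℝ) (hN : (k * s).choose 2 ≠ 0) :
    inn (ringQ k s γ) (fun _ => -1) = γ * ringEdges k s - (ringEdgePairs k s).card := by
  have hN' : ((k * s).choose 2 : ℝ) ≠ 0 := by exact_mod_cast hN
  simp only [inn, ringQ, mul_neg, mul_one, neg_sub, Finset.sum_sub_distrib, sum_ringVec]
  simp only [Finset.sum_const, Finset.card_univ, card_pairIdx, nsmul_eq_mul]
  field_simp

theorem le_inn_ringQ_self (k s : ℕ) (γ : ℝ) :
    ((ringEdgePairs k s).card : ℝ) *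
        (1 - 2 * (γ * ((ringEdges k s : ℝ) / ((k * s).choose 2 : ℝ)))) ≤
      inn (ringQ k s γ) (ringQ k s γ) := by
  rw [← sum_ringVec, Finset.sum_mul]
  refine Finset.sum_le_sum fun p _ => ?_
  have hv : ringVec k s p * ringVec k s p = ringVec k s p := by
    unfold ringVec; split_ifs <;> norm_num
  unfold ringQ
  nlinarith [sq_nonneg (γ * ((ringEdges k s : ℝ) / ((k * s).choose 2 : ℝ)))]

theorem tendsto_lat_ringQ {s : ℕ} (hs : 2 ≤ s) {γ : ℝ} (hγ : 0 < γ) :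
    Tendsto (fun k => lat (ringQ k s γ)) atTop (nhds (π / 2)) := by
  rw [← arccos_zero]
  refine (continuous_arccos.tendsto 0).comp ?_
  set M : ℝ := (s.choose 2 : ℝ) + 1
  have hM : 0 < M := by positivity
  set D : ℝ := γ * M + (s ^ 2 + 2 * s)
  have hlim : Tendsto (fun k : ℕ => D / √((k : ℝ) / 2)) atTop (nhds 0) :=
    tendsto_const_nhds.div_atTop (tendsto_sqrt_atTop.comp
      (tendsto_natCast_atTop_atTop.atTop_div_const two_pos))
  refine squeeze_zero_norm' ?_ hlim
  filter_upwards [eventually_gt_atTop 0,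
    tendsto_natCast_atTop_atTop.eventually_ge_atTop (4 * γ * M)] with k hk hkM
  have hk' : (0 : ℝ) < k := by exact_mod_cast hk
  have hN : (k : ℝ) ^ 2 ≤ ((k * s).choose 2 : ℝ) := by exact_mod_cast sq_le_choose_mul_two hs
  have hN0 : (0 : ℝ) < ((k * s).choose 2 : ℝ) := lt_of_lt_of_le (by positivity) hN
  have hcard : ((ringEdgePairs k s).card : ℝ) ≤ k * (s ^ 2 + 2 * s) := by
    exact_mod_cast card_ringEdgePairs_le k (by omega)
  have hcard' : (k : ℝ) ≤ (ringEdgePairs k s).card := by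
    exact_mod_cast le_card_ringEdgePairs k hs
  have hm : (ringEdges k s : ℝ) = k * M := by simp [ringEdges, M]; ring
  have hdens : γ * ((ringEdges k s : ℝ) / ((k * s).choose 2 : ℝ)) ≤ 1 / 4 := by
    rw [hm, ← mul_div_assoc, div_le_iff₀ hN0]
    nlinarith
  have hq : (k : ℝ) / 2 ≤ inn (ringQ k s γ) (ringQ k s γ) := by
    refine le_trans ?_ (le_inn_ringQ_self k s γ)
    nlinarith
  have hnum : |inn (ringQ k s γ) (fun _ => -1)| ≤ D * k := by
    rw [inn_ringQ_neg_one γ (by exact_mod_cast hN0.ne'), hm, abs_le]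
    have : 0 ≤ γ * (k * M) := by positivity
    constructor <;> simp only [D] <;> nlinarith
  have hsqrt : (k : ℝ) ≤ √((k * s).choose 2 : ℝ) := Real.le_sqrt_of_sq_le hN
  have hD : 0 ≤ D := by positivity
  rw [nrm_neg_one, Real.norm_eq_abs, abs_div, abs_of_nonneg (a := nrm _ * _)
    (mul_nonneg (Real.sqrt_nonneg _) (Real.sqrt_nonneg _))]
  calc |inn (ringQ k s γ) (fun _ => -1)| / (nrm (ringQ k s γ) * √((k * s).choose 2 : ℝ))
      ≤ (D * k) / (√((k : ℝ) / 2) * k) := by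
        gcongr
        · exact Real.sqrt_nonneg _
        · exact Real.sqrt_le_sqrt hq
    _ = D / √((k : ℝ) / 2) := mul_div_mul_right _ _ (by positivity)

/-- for the ring of k cliques of fixed size s ≥ 2, as k → ∞:
(a) ℓ(b(T_{k,s})) → 0; (b) for fixed γ > 0, ℓ(q) → π/2; and consequently
d_a(q, b(T_{k,s})) ≥ |ℓ(q) − ℓ(b(T_{k,s}))| → π/2. -/
theorem stmt19 (s : ℕ) (hs : 2 ≤ s) (γ : ℝ) (hγ : 0 < γ) :
    Filter.Tendsto (fun k => lat (bvec (cliqueOf k s))) Filter.atTop (nhds 0) ∧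
    Filter.Tendsto (fun k => lat (ringQ k s γ)) Filter.atTop (nhds (π / 2)) ∧
    (∀ k, |lat (ringQ k s γ) - lat (bvec (cliqueOf k s))| ≤
        angDist (ringQ k s γ) (bvec (cliqueOf k s))) ∧
    Filter.Tendsto (fun k => |lat (ringQ k s γ) - lat (bvec (cliqueOf k s))|)
      Filter.atTop (nhds (π / 2)) := by
  have hb := tendsto_lat_bvec hs
  have hq := tendsto_lat_ringQ hs hγ
  refine ⟨hb, hq, fun k => abs_lat_sub_lat_le_angDist _ _, ?_⟩
  have h := (hq.sub hb).abs
  rwa [sub_zero, abs_of_pos (by positivity)] at h
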